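/- Let k ≥ 1, let (r_n) be the all-one pattern sequence over F_2 (p = 2, a = 2^k − 1), let R = Σ_{i≥1} r_{i−1} x^{-i} ∈ F_2((x^{-1})) with partial quotients A_j of its continued fraction expansion, and define the convergent denominators by Q_{-1} = 0, Q_0 = 1, Q_j = A_j·Q_{j−1} + Q_{j−2} for j ≥ 1. If k = 1, then Q_j ≡ 1 (mod x+1) for all j ≥ 0; if k ≥ 2, then Q_{2j} ≡ 1 (mod x^{2^{k−1}} + 1) and Q_{2j+1} ≡ x + 1 (mod x^{2^{k−1}} + 1) for all j ≥ 0. -/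

import Mathlib

noncomputable section

/-- The element `x` of `F₂((x⁻¹))`: the field of formal Laurent series in `x⁻¹` is modelled
as `LaurentSeries (ZMod 2)` whose variable represents `x⁻¹`, so `x` is its inverse.
The coefficient of `x^{-i}` of an element `R` is then `R.coeff i`. -/
def xVar : LaurentSeries (ZMod 2) :=
  ((PowerSeries.X : PowerSeries (ZMod 2)) : LaurentSeries (ZMod 2))⁻¹

/-- The embedding of `F₂[x]` into `F₂((x⁻¹))`. -/
def polyToLaurent (P : Polynomial (ZMod 2)) : LaurentSeries (ZMod 2) :=
  Polynomial.aeval xVar P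

/-- The polynomial part `Pol(R) ∈ F₂[x]` of `R = ∑_{i ≥ -m} r_i x^{-i}`, i.e.
`∑_{i = -m}^{0} r_i x^{-i}`, viewed as a polynomial in `x`. -/
def polPart (R : LaurentSeries (ZMod 2)) : Polynomial (ZMod 2) :=
  ∑ j ∈ Finset.range ((-R.order).toNat + 1),
    Polynomial.C (R.coeff (-(j : ℤ))) * Polynomial.X ^ j

/-- The remainders in the continued fraction algorithm:
`B₀ = R - Pol(R)`, `B_{j+1} = B_j⁻¹ - Pol(B_j⁻¹)`. -/
def cfB (R : LaurentSeries (ZMod 2)) : ℕ → LaurentSeries (ZMod 2)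
  | 0 => R - polyToLaurent (polPart R)
  | j + 1 => (cfB R j)⁻¹ - polyToLaurent (polPart ((cfB R j)⁻¹))

/-- The partial quotients of the continued fraction expansion:
`A₀ = Pol(R)`, `A_{j+1} = Pol(B_j⁻¹)`. -/
def cfA (R : LaurentSeries (ZMod 2)) : ℕ → Polynomial (ZMod 2)
  | 0 => polPart R
  | j + 1 => polPart ((cfB R j)⁻¹)

/-- The denominators of the convergents of the continued fraction expansion of `R`,
indexed with a shift: `convDen R 0 = Q₋₁ = 0`, `convDen R 1 = Q₀ = 1`, and
`convDen R (j+2) = Q_{j+1} = A_{j+1} Q_j + Q_{j-1}`. -/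
def convDen (R : LaurentSeries (ZMod 2)) : ℕ → Polynomial (ZMod 2)
  | 0 => 0
  | 1 => 1
  | j + 2 => cfA R (j + 1) * convDen R (j + 1) + convDen R j

/-- The field `F₂((x⁻¹))` has characteristic two. -/
lemma laurent_two_eq_zero : (2 : LaurentSeries (ZMod 2)) = 0 := by
  have h := congrArg (HahnSeries.C : ZMod 2 →+* LaurentSeries (ZMod 2))
    (show ((2 : ℕ) : ZMod 2) = 0 from rfl)
  rw [map_natCast, map_zero] at h
  exact_mod_cast h

lemma coe_X_ne_zero :
    ((PowerSeries.X : PowerSeries (ZMod 2)) : LaurentSeries (ZMod 2)) ≠ 0 := by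
  rw [HahnSeries.ofPowerSeries_X]
  simp

lemma xVar_add_one_mul_coe_X :
    (xVar + 1) * ((PowerSeries.X : PowerSeries (ZMod 2)) : LaurentSeries (ZMod 2)) =
      1 + ((PowerSeries.X : PowerSeries (ZMod 2)) : LaurentSeries (ZMod 2)) := by
  rw [add_mul, one_mul, xVar, inv_mul_cancel₀ coe_X_ne_zero]

lemma xVar_pow (n : ℕ) : xVar ^ n = HahnSeries.single (-(n : ℤ)) 1 := by
  rw [xVar, HahnSeries.ofPowerSeries_X, HahnSeries.inv_single, HahnSeries.single_pow]
  simp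

lemma coeff_polyToLaurent (A : Polynomial (ZMod 2)) (j : ℕ) :
    (polyToLaurent A).coeff (-(j : ℤ)) = A.coeff j := by
  induction A using Polynomial.induction_on' with
  | add p q hp hq => simp_all [polyToLaurent]
  | monomial n a =>
    have hC : algebraMap (ZMod 2) (LaurentSeries (ZMod 2)) = HahnSeries.C := Subsingleton.elim _ _
    rw [polyToLaurent, Polynomial.aeval_monomial, xVar_pow, Polynomial.coeff_monomial, hC,
      HahnSeries.C_apply, HahnSeries.single_mul_single, HahnSeries.coeff_single]
    by_cases h : n = j
    · simp [h]
    · have : ¬ j = n := fun e => h e.symm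
      simp [h, this]

lemma coeff_polPart (R : LaurentSeries (ZMod 2)) (j : ℕ) :
    (polPart R).coeff j = R.coeff (-(j : ℤ)) := by
  simp only [polPart, Polynomial.finsetSum_coeff, Polynomial.coeff_C_mul,
    Polynomial.coeff_X_pow, mul_ite, mul_one, mul_zero, Finset.sum_ite_eq, Finset.mem_range]
  split_ifs with h
  · rfl
  · exact (HahnSeries.coeff_eq_zero_of_lt_order (by omega)).symm

lemma coeff_coe_X_mul (q : PowerSeries (ZMod 2)) (j : ℕ) :
    ((PowerSeries.X * q : PowerSeries (ZMod 2)) : LaurentSeries (ZMod 2)).coeff (-(j : ℤ)) = 0 := by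
  rcases Nat.eq_zero_or_pos j with rfl | hj
  · have := LaurentSeries.coeff_coe_powerSeries (PowerSeries.X * q) 0
    simpa using this
  · rw [PowerSeries.coeff_coe, if_pos (by omega)]

/-- A series is its polynomial part as soon as the difference vanishes at infinity. -/
lemma polPart_eq {z : LaurentSeries (ZMod 2)} (A : Polynomial (ZMod 2)) (q : PowerSeries (ZMod 2))
    (h : z = polyToLaurent A + ((PowerSeries.X * q : PowerSeries (ZMod 2)) :
      LaurentSeries (ZMod 2))) : polPart z = A := by
  ext j
  rw [coeff_polPart, h, HahnSeries.coeff_add, coeff_polyToLaurent, coeff_coe_X_mul, add_zero]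

/-- One step of the continued fraction algorithm. -/
lemma cf_step {R z w : LaurentSeries (ZMod 2)} {j : ℕ} (A : Polynomial (ZMod 2))
    (q : PowerSeries (ZMod 2)) (hB : cfB R j = z) (hz : z⁻¹ = polyToLaurent A + w)
    (hw : w = ((PowerSeries.X * q : PowerSeries (ZMod 2)) : LaurentSeries (ZMod 2))) :
    cfA R (j + 1) = A ∧ cfB R (j + 1) = w := by
  have hp : polPart z⁻¹ = A := polPart_eq A q (by rw [hz, hw])
  simp only [cfA, cfB, hB, hp]
  exact ⟨trivial, by rw [hz]; ring⟩

lemma cfB_zero_of_coe_X_mul (q : PowerSeries (ZMod 2)) :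
    cfB ((PowerSeries.X * q : PowerSeries (ZMod 2)) : LaurentSeries (ZMod 2)) 0 =
      ((PowerSeries.X * q : PowerSeries (ZMod 2)) : LaurentSeries (ZMod 2)) := by
  have hp := polPart_eq (z := ((PowerSeries.X * q : PowerSeries (ZMod 2)) :
    LaurentSeries (ZMod 2))) 0 q (by simp [polyToLaurent])
  rw [cfB, hp, polyToLaurent, map_zero, sub_zero]

/-- Over `F₂`, squaring a power series substitutes `X ^ 2` for the variable. -/
lemma coeff_sq_zmod_two (f : PowerSeries (ZMod 2)) (n : ℕ) :
    PowerSeries.coeff n (f ^ 2) = if 2 ∣ n then PowerSeries.coeff (n / 2) f else 0 := by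
  have h : frobenius (ZMod 2) 2 = RingHom.id (ZMod 2) := ZMod.frobenius_zmod 2
  rw [← MvPowerSeries.map_frobenius_expand 2 two_ne_zero, h]
  exact PowerSeries.coeff_expand 2 two_ne_zero f

section AllOnePattern

variable {k : ℕ} {r : ℕ → ZMod 2}

lemma allOnePattern_of_lt (hr0 : r 0 = 0)
    (hrec : ∀ n, 1 ≤ n → r n = r (n / 2) + if n % 2 ^ k = 2 ^ k - 1 then 1 else 0)
    (n : ℕ) (hn : n < 2 ^ k - 1) : r n = 0 := by
  induction n using Nat.strong_induction_on with
  | _ n ih =>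
    rcases Nat.eq_zero_or_pos n with rfl | hpos
    · exact hr0
    · rw [hrec n hpos, ih (n / 2) (by omega) (by omega), Nat.mod_eq_of_lt (by omega),
        if_neg (by omega), add_zero]

lemma allOnePattern_first_one (hk : 1 ≤ k) (hr0 : r 0 = 0)
    (hrec : ∀ n, 1 ≤ n → r n = r (n / 2) + if n % 2 ^ k = 2 ^ k - 1 then 1 else 0) :
    r (2 ^ k - 1) = 1 := by
  have h2 : 2 ≤ 2 ^ k := by
    calc 2 = 2 ^ 1 := rfl
      _ ≤ 2 ^ k := Nat.pow_le_pow_right (by norm_num) hk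
  rw [hrec _ (by omega), allOnePattern_of_lt hr0 hrec _ (by omega), Nat.mod_eq_of_lt (by omega),
    if_pos rfl, zero_add]

/-- The generating series of the pattern sequence is `X ^ (2 ^ k - 1)` times a series with
constant coefficient one. -/
lemma allOnePattern_factor (hk : 1 ≤ k) (hr0 : r 0 = 0)
    (hrec : ∀ n, 1 ≤ n → r n = r (n / 2) + if n % 2 ^ k = 2 ^ k - 1 then 1 else 0) :
    ∃ s : PowerSeries (ZMod 2),
      PowerSeries.mk r = PowerSeries.X ^ (2 ^ k - 1) * (1 + PowerSeries.X * s) := by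
  obtain ⟨u, hu⟩ := PowerSeries.X_pow_dvd_iff.mpr
    (fun n hn => (PowerSeries.coeff_mk n r).trans (allOnePattern_of_lt hr0 hrec n hn))
  have h1 : PowerSeries.constantCoeff u = 1 := by
    have := congrArg (PowerSeries.coeff (2 ^ k - 1)) hu
    rw [PowerSeries.coeff_mk, allOnePattern_first_one hk hr0 hrec] at this
    simpa [PowerSeries.coeff_X_pow_mul'] using this.symm
  obtain ⟨s, hs⟩ := PowerSeries.X_dvd_iff.mpr
    (show PowerSeries.constantCoeff (u - 1) = 0 by simp [h1])
  exact ⟨s, by rw [hu, ← hs]; ring⟩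

lemma allOnePattern_mahler (hk : 1 ≤ k) (hr0 : r 0 = 0)
    (hrec : ∀ n, 1 ≤ n → r n = r (n / 2) + if n % 2 ^ k = 2 ^ k - 1 then 1 else 0) :
    PowerSeries.mk r = (1 + PowerSeries.X) * PowerSeries.mk r ^ 2 +
      PowerSeries.mk fun n => if n % 2 ^ k = 2 ^ k - 1 then (1 : ZMod 2) else 0 := by
  have h2 : 2 ≤ 2 ^ k := by
    calc 2 = 2 ^ 1 := rfl
      _ ≤ 2 ^ k := Nat.pow_le_pow_right (by norm_num) hk
  ext n
  rw [map_add, add_mul, one_mul, map_add, PowerSeries.coeff_mk, PowerSeries.coeff_mk,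
    coeff_sq_zmod_two]
  cases n with
  | zero =>
    have : ¬ 0 = 2 ^ k - 1 := by omega
    simp [hr0, this]
  | succ m =>
    rw [PowerSeries.coeff_succ_X_mul, coeff_sq_zmod_two, hrec (m + 1) (by omega)]
    congr 1
    simp only [PowerSeries.coeff_mk]
    rcases Nat.even_or_odd' m with ⟨c, rfl | rfl⟩
    · rw [if_neg (by omega), if_pos (by omega), zero_add]
      congr 1; omega
    · rw [if_pos (by omega), if_neg (by omega), add_zero]

lemma one_add_X_pow_two_pow_mul_mk (k : ℕ) :
    (1 + PowerSeries.X) ^ 2 ^ k *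
      PowerSeries.mk (fun n => if n % 2 ^ k = 2 ^ k - 1 then (1 : ZMod 2) else 0) =
    PowerSeries.X ^ (2 ^ k - 1) := by
  have hpos : 0 < 2 ^ k := by positivity
  have hX : (1 + PowerSeries.X : PowerSeries (ZMod 2)) ^ 2 ^ k = 1 + PowerSeries.X ^ 2 ^ k := by
    have := congrArg (Polynomial.coeToPowerSeries.ringHom (R := ZMod 2))
      (add_pow_char_pow (p := 2) (n := k) (1 : Polynomial (ZMod 2)) Polynomial.X)
    simpa using this
  rw [hX]
  ext n
  rw [add_mul, one_mul, map_add, PowerSeries.coeff_X_pow_mul', PowerSeries.coeff_mk,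
    PowerSeries.coeff_X_pow]
  by_cases h : 2 ^ k ≤ n
  · rw [if_pos h, PowerSeries.coeff_mk, ← Nat.mod_eq_sub_mod h, CharTwo.add_self_eq_zero,
      if_neg (by omega)]
  · rw [if_neg h, Nat.mod_eq_of_lt (by omega), add_zero]

/-- The quadratic equation satisfied by the generating series in `F₂((x⁻¹))`. -/
lemma allOnePattern_quadratic (hk : 1 ≤ k) (hr0 : r 0 = 0)
    (hrec : ∀ n, 1 ≤ n → r n = r (n / 2) + if n % 2 ^ k = 2 ^ k - 1 then 1 else 0)
    {R : LaurentSeries (ZMod 2)}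
    (hR : R = ((PowerSeries.X * PowerSeries.mk r : PowerSeries (ZMod 2)) :
      LaurentSeries (ZMod 2))) :
    (xVar + 1) ^ 2 ^ k * R = (xVar + 1) ^ (2 ^ k + 1) * R ^ 2 + 1 := by
  have h := congrArg (fun f => PowerSeries.X * ((1 + PowerSeries.X) ^ 2 ^ k * f))
    (allOnePattern_mahler hk hr0 hrec)
  simp only [mul_add ((1 + PowerSeries.X : PowerSeries (ZMod 2)) ^ 2 ^ k),
    one_add_X_pow_two_pow_mul_mk] at h
  rw [mul_add, ← pow_succ', Nat.sub_add_cancel Nat.one_le_two_pow] at h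
  have h' := congrArg (HahnSeries.ofPowerSeries ℤ (ZMod 2)) h
  simp only [map_mul, map_add, map_pow, map_one] at h'
  have hX := coe_X_ne_zero
  rw [map_mul] at hR
  rw [hR]
  refine mul_left_cancel₀ (pow_ne_zero (2 ^ k) hX) ?_
  simp only [← xVar_add_one_mul_coe_X] at h'
  generalize xVar + 1 = t at *
  linear_combination h'

lemma polyToLaurent_X_add_one_pow (n : ℕ) :
    polyToLaurent ((Polynomial.X + 1) ^ n) = (xVar + 1) ^ n := by
  simp [polyToLaurent]

/-- The continued fraction expansion of the pattern series for `k = 1`: its partial quotients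
are `t ^ 2 + t + 1, t ^ 2, t ^ 2, …` with `t = x + 1`. -/
lemma allOnePattern_cf_one (hr0 : r 0 = 0)
    (hrec : ∀ n, 1 ≤ n → r n = r (n / 2) + if n % 2 ^ 1 = 2 ^ 1 - 1 then 1 else 0)
    {R : LaurentSeries (ZMod 2)}
    (hR : R = ((PowerSeries.X * PowerSeries.mk r : PowerSeries (ZMod 2)) :
      LaurentSeries (ZMod 2))) (j : ℕ) :
    cfA R (j + 1) = (Polynomial.X + 1) ^ 2 + (if j = 0 then Polynomial.X + 1 + 1 else 0) ∧
      cfB R (j + 1) = (xVar + 1) ^ 4 * R ^ 2 + 1 := by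
  have e := allOnePattern_quadratic le_rfl hr0 hrec hR
  have h2 := laurent_two_eq_zero
  obtain ⟨s, hs⟩ := allOnePattern_factor le_rfl hr0 hrec
  have hw : (xVar + 1) ^ 4 * R ^ 2 + 1 = ((PowerSeries.X * (PowerSeries.X ^ 3 +
      (1 + PowerSeries.X ^ 4) * PowerSeries.X * s ^ 2) : PowerSeries (ZMod 2)) :
      LaurentSeries (ZMod 2)) := by
    have hx := xVar_add_one_mul_coe_X
    rw [hR, hs]
    simp only [map_mul, map_add, map_pow, map_one]
    generalize HahnSeries.ofPowerSeries ℤ (ZMod 2) PowerSeries.X = x at *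
    generalize HahnSeries.ofPowerSeries ℤ (ZMod 2) s = u at *
    have h4 : (xVar + 1) ^ 4 * (x * (x ^ (2 ^ 1 - 1) * (1 + x * u))) ^ 2 =
        (1 + x) ^ 4 * (1 + x * u) ^ 2 := by
      rw [← hx]; ring
    rw [h4]
    linear_combination (1 + 2 * x + 3 * x ^ 2 + 2 * x ^ 3 + x * u * (1 + x) ^ 4 +
      (2 * x + 3 * x ^ 2 + 2 * x ^ 3) * x ^ 2 * u ^ 2) * h2
  induction j with
  | zero =>
    have h0 : cfB R 0 = R := by rw [hR]; exact cfB_zero_of_coe_X_mul _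
    refine cf_step _ _ h0 (inv_eq_of_mul_eq_one_right ?_) hw
    rw [if_pos rfl]
    have hA : polyToLaurent ((Polynomial.X + 1) ^ 2 + (Polynomial.X + 1 + 1)) =
        (xVar + 1) ^ 2 + (xVar + 1 + 1) := by
      simp [polyToLaurent]
    rw [hA]
    linear_combination (1 - (xVar + 1) * R) * e + (R + (xVar + 1) ^ 3 * R ^ 2) * h2
  | succ j ih =>
    refine cf_step _ _ ih.2 (inv_eq_of_mul_eq_one_right ?_) hw
    rw [if_neg (by omega), add_zero, polyToLaurent_X_add_one_pow]
    generalize xVar + 1 = t at *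
    linear_combination t ^ 2 * (t ^ 2 * R + t ^ 3 * R ^ 2 + 1) * e +
      (t ^ 8 * R ^ 4 + t ^ 2 + t ^ 5 * R ^ 2 + t ^ 4 * R ^ 2) * h2

/-- The continued fraction expansion of the pattern series for `k ≥ 2`: with `t = x + 1` and
`N = 2 ^ k`, its partial quotients are `t ^ N + t, t ^ (N - 2), t ^ N, t ^ (N - 2), t ^ N, …`. -/
lemma allOnePattern_cf (hk : 2 ≤ k) (hr0 : r 0 = 0)
    (hrec : ∀ n, 1 ≤ n → r n = r (n / 2) + if n % 2 ^ k = 2 ^ k - 1 then 1 else 0)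
    {R : LaurentSeries (ZMod 2)}
    (hR : R = ((PowerSeries.X * PowerSeries.mk r : PowerSeries (ZMod 2)) :
      LaurentSeries (ZMod 2))) (j : ℕ) :
    cfA R (2 * j + 1) = (Polynomial.X + 1) ^ 2 ^ k + (if j = 0 then Polynomial.X + 1 else 0) ∧
      cfA R (2 * j + 2) = (Polynomial.X + 1) ^ (2 ^ k - 2) := by
  have e := allOnePattern_quadratic (by omega) hr0 hrec hR
  have h2 := laurent_two_eq_zero
  obtain ⟨s, hs⟩ := allOnePattern_factor (by omega) hr0 hrec
  have hN : 4 ≤ 2 ^ k := by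
    calc 4 = 2 ^ 2 := rfl
      _ ≤ 2 ^ k := Nat.pow_le_pow_right (by norm_num) hk
  obtain ⟨n, hn⟩ := Nat.exists_eq_add_of_le' hN
  rw [hn] at e hs ⊢
  have hRx : R = ((PowerSeries.X : PowerSeries (ZMod 2)) : LaurentSeries (ZMod 2)) ^ (n + 4) *
      ((1 + PowerSeries.X * s : PowerSeries (ZMod 2)) : LaurentSeries (ZMod 2)) := by
    rw [hR, hs, ← mul_assoc, ← pow_succ', map_mul, map_pow]
    rfl
  have hodd : (xVar + 1) ^ (n + 6) * R ^ 2 = ((PowerSeries.X * ((1 + PowerSeries.X) ^ (n + 6) *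
      PowerSeries.X ^ (n + 1) * (1 + PowerSeries.X * s) ^ 2) : PowerSeries (ZMod 2)) :
      LaurentSeries (ZMod 2)) := by
    simp only [hRx, map_mul, map_pow, map_add (HahnSeries.ofPowerSeries ℤ (ZMod 2)) 1 PowerSeries.X,
      map_one, ← xVar_add_one_mul_coe_X]
    generalize xVar + 1 = t
    ring
  have heven : (xVar + 1) ^ (n + 4) * R ^ 2 = ((PowerSeries.X * ((1 + PowerSeries.X) ^ (n + 4) *
      PowerSeries.X ^ (n + 3) * (1 + PowerSeries.X * s) ^ 2) : PowerSeries (ZMod 2)) :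
      LaurentSeries (ZMod 2)) := by
    simp only [hRx, map_mul, map_pow, map_add (HahnSeries.ofPowerSeries ℤ (ZMod 2)) 1 PowerSeries.X,
      map_one, ← xVar_add_one_mul_coe_X]
    generalize xVar + 1 = t
    ring
  have hstep : ∀ i, cfB R (2 * i + 1) = (xVar + 1) ^ (n + 6) * R ^ 2 →
      cfA R (2 * i + 2) = (Polynomial.X + 1) ^ (n + 4 - 2) ∧
        cfB R (2 * i + 2) = (xVar + 1) ^ (n + 4) * R ^ 2 := fun i hi => by
    refine cf_step _ _ hi (inv_eq_of_mul_eq_one_right ?_) heven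
    rw [polyToLaurent_X_add_one_pow, show n + 4 - 2 = n + 2 by omega]
    generalize xVar + 1 = t at *
    linear_combination (t ^ (n + 4) * R + t ^ (n + 5) * R ^ 2 + 1) * e +
      (t ^ (2 * n + 10) * R ^ 4 + t ^ (n + 5) * R ^ 2) * h2
  have hmain : ∀ i, cfA R (2 * i + 1) =
      (Polynomial.X + 1) ^ (n + 4) + (if i = 0 then Polynomial.X + 1 else 0) ∧
        cfB R (2 * i + 1) = (xVar + 1) ^ (n + 6) * R ^ 2 := fun i => by
    induction i with
    | zero =>
      have h0 : cfB R 0 = R := by rw [hR]; exact cfB_zero_of_coe_X_mul _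
      refine cf_step _ _ h0 (inv_eq_of_mul_eq_one_right ?_) hodd
      have hA : polyToLaurent ((Polynomial.X + 1) ^ (n + 4) + (Polynomial.X + 1)) =
          (xVar + 1) ^ (n + 4) + (xVar + 1) := by
        simp [polyToLaurent]
      rw [if_pos rfl, hA]
      generalize xVar + 1 = t at *
      linear_combination (1 - t * R) * e + t ^ (n + 5) * R ^ 2 * h2
    | succ i ih =>
      refine cf_step _ _ (hstep i ih.2).2 (inv_eq_of_mul_eq_one_right ?_) hodd
      rw [if_neg (by omega), add_zero, polyToLaurent_X_add_one_pow]
      generalize xVar + 1 = t at *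
      linear_combination (t ^ (n + 4) * R + t ^ (n + 5) * R ^ 2 + 1) * e +
        (t ^ (2 * n + 10) * R ^ 4 + t ^ (n + 5) * R ^ 2) * h2
  exact ⟨(hmain j).1, (hstep j (hmain j).2).1⟩

end AllOnePattern

/-- For the all-one pattern sequence `r` (pattern `11⋯1` of length `k`) and
`R = ∑_{i ≥ 1} r_{i-1} x^{-i}`: if `k = 1` then `Q_j ≡ 1 (mod x+1)` for all `j ≥ 0`, and if
`k ≥ 2` then `Q_{2j} ≡ 1` and `Q_{2j+1} ≡ x + 1 (mod x^(2^(k-1)) + 1)` for all `j ≥ 0`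
(here `Q_j = convDen R (j+1)`). -/
theorem allOnePattern_convergent_denominators (k : ℕ) (hk : 1 ≤ k)
    (r : ℕ → ZMod 2) (hr0 : r 0 = 0)
    (hrec : ∀ n, 1 ≤ n → r n = r (n / 2) + if n % 2 ^ k = 2 ^ k - 1 then 1 else 0)
    (R : LaurentSeries (ZMod 2))
    (hR : R = ((PowerSeries.X * PowerSeries.mk r : PowerSeries (ZMod 2)) :
      LaurentSeries (ZMod 2))) :
    (k = 1 → ∀ j : ℕ, (Polynomial.X + 1 : Polynomial (ZMod 2)) ∣ (convDen R (j + 1) - 1)) ∧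
    (2 ≤ k → ∀ j : ℕ,
      (Polynomial.X ^ 2 ^ (k - 1) + 1 : Polynomial (ZMod 2)) ∣ (convDen R (2 * j + 1) - 1) ∧
      (Polynomial.X ^ 2 ^ (k - 1) + 1 : Polynomial (ZMod 2)) ∣
        (convDen R (2 * j + 2) - (Polynomial.X + 1))) := by
  refine ⟨?_, fun hk2 => ?_⟩
  · rintro rfl j
    have hA := fun i => (allOnePattern_cf_one hr0 hrec hR i).1
    induction j using Nat.strong_induction_on with
    | _ j ih =>
      match j with
      | 0 => simp [convDen]
      | 1 =>
        rw [convDen, hA 0, if_pos rfl, convDen, convDen]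
        exact ⟨Polynomial.X + 1 + 1, by ring⟩
      | j + 2 =>
        rw [convDen, hA (j + 1), if_neg (by omega), add_zero, add_sub_assoc]
        exact dvd_add (Dvd.dvd.mul_right (dvd_pow_self _ two_ne_zero) _) (ih j (by omega))
  · have hA := allOnePattern_cf hk2 hr0 hrec hR
    obtain ⟨m, rfl⟩ := Nat.exists_eq_add_of_le' hk
    have hm : 2 ≤ 2 ^ m := by
      calc 2 = 2 ^ 1 := rfl
        _ ≤ 2 ^ m := Nat.pow_le_pow_right (by norm_num) (by omega)
    have hD : (Polynomial.X ^ 2 ^ m + 1 : Polynomial (ZMod 2)) = (Polynomial.X + 1) ^ 2 ^ m := by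
      rw [add_pow_char_pow, one_pow]
    rw [Nat.add_sub_cancel, hD]
    have hdvd : ∀ i, 2 ^ m ≤ i →
        ((Polynomial.X + 1) ^ 2 ^ m : Polynomial (ZMod 2)) ∣ (Polynomial.X + 1) ^ i :=
      fun i hi => pow_dvd_pow _ hi
    intro j
    induction j with
    | zero =>
      refine ⟨by simp [convDen], ?_⟩
      rw [convDen, (hA 0).1, if_pos rfl, convDen, convDen, add_zero, mul_one, add_sub_cancel_right]
      exact hdvd _ (by rw [pow_succ]; omega)
    | succ j ih =>
      have h1 : ((Polynomial.X + 1) ^ 2 ^ m : Polynomial (ZMod 2)) ∣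
          convDen R (2 * j + 3) - 1 := by
        rw [convDen, (hA j).2, add_sub_assoc]
        exact dvd_add (Dvd.dvd.mul_right (hdvd _ (by rw [pow_succ]; omega)) _) ih.1
      refine ⟨h1, ?_⟩
      rw [convDen, (hA (j + 1)).1, if_neg (by omega), add_zero, add_sub_assoc]
      exact dvd_add (Dvd.dvd.mul_right (hdvd _ (by rw [pow_succ]; omega)) _) ih.2
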